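/- arXiv:1512.04493 — 2 statements merged into one kernel-verified Lean document; each statement's English description precedes it below -/
import Mathlib

section
/- Conservation of particles in the hydrodynamic limit: let z : [1/2,∞) → ℝ be a continuous nondecreasing solution of the Stefan integral equation with z(1/2) = 0, extend z by z(s) := 0 for 0 ≤ s ≤ 1/2, and define U*(t,x) := 2p(t,x) + ∫₀ᵗ p_N(t−s, z(s), x) ds for t ≥ 1/2 and x ≥ z(t). Then U*(t, z(t)) = 4/√π for every t ≥ 1/2. -/
open MeasureTheory Real Set

/-- The heat kernel `p(t,x) = (2πt)^{-1/2} exp(-x²/(2t))`. -/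
noncomputable def heatK (t x : ℝ) : ℝ :=
  (Real.sqrt (2 * Real.pi * t))⁻¹ * Real.exp (-x ^ 2 / (2 * t))

/-- The Gaussian tail `Φ̃(t,x) = ∫ₓ^∞ p(t,y) dy`. -/
noncomputable def gaussTail (t x : ℝ) : ℝ := ∫ y in Set.Ioi x, heatK t y

/-- The density `u₁(t,x) = -2∂ₓp(t,x) + 4Φ̃(t,x) = (2x/t)p(t,x) + 4Φ̃(t,x)`. -/
noncomputable def u1 (t x : ℝ) : ℝ := (2 * x / t) * heatK t x + 4 * gaussTail t x

/-- The profile `U_{**}(y) = ∫₀^y u₁(1/2, w) dw`. -/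
noncomputable def Ustst (y : ℝ) : ℝ := ∫ w in (0:ℝ)..y, u1 (1 / 2) w

/-- The Neumann heat kernel `p_N(t,y,x) = p(t,y-x) + p(t,y+x)`. -/
noncomputable def heatKN (t y x : ℝ) : ℝ := heatK t (y - x) + heatK t (y + x)

open Filter Topology

section HeatKernel

theorem heatK_nonneg (t x : ℝ) : 0 ≤ heatK t x := by unfold heatK; positivity

theorem heatK_of_nonpos {t : ℝ} (ht : t ≤ 0) (x : ℝ) : heatK t x = 0 := by
  have : 2 * π * t ≤ 0 := mul_nonpos_of_nonneg_of_nonpos (by positivity) ht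
  simp [heatK, Real.sqrt_eq_zero_of_nonpos this]

theorem heatK_neg (t x : ℝ) : heatK t (-x) = heatK t x := by simp [heatK]

theorem heatK_sub_comm (t x y : ℝ) : heatK t (x - y) = heatK t (y - x) := by
  rw [← heatK_neg, neg_sub]

theorem heatK_abs (t x : ℝ) : heatK t |x| = heatK t x := by simp [heatK]

theorem heatK_le (t x : ℝ) : heatK t x ≤ (√(2 * π * t))⁻¹ := by
  rcases le_or_gt t 0 with ht | ht
  · rw [heatK_of_nonpos ht]; positivity
  · unfold heatK
    refine mul_le_of_le_one_right (by positivity) (Real.exp_le_one_iff.2 ?_)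
    exact div_nonpos_of_nonpos_of_nonneg (by nlinarith [sq_nonneg x]) (by positivity)

theorem heatK_eq_gaussianPDFReal {t : ℝ} (ht : 0 ≤ t) (x y : ℝ) :
    heatK t (x - y) = ProbabilityTheory.gaussianPDFReal y ⟨t, ht⟩ x := by
  simp only [heatK, ProbabilityTheory.gaussianPDFReal]
  rfl

theorem integrable_heatK (t : ℝ) : Integrable (heatK t) := by
  rcases le_or_gt t 0 with ht | ht
  · rw [show heatK t = fun _ => 0 from funext fun x => heatK_of_nonpos ht x]
    exact integrable_zero _ _ _
  · have := ProbabilityTheory.integrable_gaussianPDFReal 0 ⟨t, ht.le⟩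
    refine this.congr (Eventually.of_forall fun x => ?_)
    rw [← heatK_eq_gaussianPDFReal, sub_zero]

theorem integral_heatK {t : ℝ} (ht : 0 < t) : ∫ x, heatK t x = 1 := by
  rw [← ProbabilityTheory.integral_gaussianPDFReal_eq_one 0 (v := ⟨t, ht.le⟩)
    (fun h => ht.ne' (congrArg NNReal.toReal h))]
  congr 1 with x
  rw [← heatK_eq_gaussianPDFReal, sub_zero]

theorem integrable_heatK_sub (t x : ℝ) : Integrable fun y => heatK t (x - y) :=
  (integrable_heatK t).comp_sub_left x

theorem integral_heatK_sub {t : ℝ} (ht : 0 < t) (x : ℝ) : ∫ y, heatK t (x - y) = 1 := by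
  rw [integral_sub_left_eq_self (heatK t), integral_heatK ht]

theorem measurable_uncurry_heatK : Measurable (Function.uncurry heatK) := by
  unfold heatK Function.uncurry
  fun_prop

theorem Measurable.heatK {α : Type*} [MeasurableSpace α] {f g : α → ℝ} (hf : Measurable f)
    (hg : Measurable g) : Measurable fun a => heatK (f a) (g a) :=
  measurable_uncurry_heatK.comp (hf.prodMk hg)

theorem continuous_heatK (t : ℝ) : Continuous (heatK t) := by
  unfold heatK
  fun_prop

/-- The product of two heat kernels is a heat kernel times a translated heat kernel. -/
theorem heatK_mul_heatK {s t : ℝ} (hs : 0 < s) (ht : 0 < t) (x y c : ℝ) :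
    heatK s (x - y) * heatK t (y - c)
      = heatK (s + t) (x - c) * heatK (s * t / (s + t)) ((t * x + s * c) / (s + t) - y) := by
  unfold heatK
  have hst : 0 < s + t := by positivity
  have e1 : ∀ a b u v : ℝ, a * exp u * (b * exp v) = a * b * exp (u + v) := fun a b u v => by
    rw [Real.exp_add]; ring
  rw [e1, e1, ← mul_inv, ← mul_inv, ← Real.sqrt_mul (by positivity),
    ← Real.sqrt_mul (by positivity)]
  congr 1
  · congr 2
    field_simp
  · congr 1
    field_simp
    ring

/-- The Chapman–Kolmogorov equation. -/
theorem integral_heatK_mul_heatK {s t : ℝ} (hs : 0 < s) (ht : 0 < t) (x c : ℝ) :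
    ∫ y, heatK s (x - y) * heatK t (y - c) = heatK (s + t) (x - c) := by
  simp_rw [heatK_mul_heatK hs ht]
  rw [integral_const_mul, integral_heatK_sub (by positivity), mul_one]

theorem integrable_heatK_mul_heatK {s t : ℝ} (hs : 0 < s) (ht : 0 < t) (x c : ℝ) :
    Integrable fun y => heatK s (x - y) * heatK t (y - c) := by
  simp_rw [heatK_mul_heatK hs ht]
  exact (integrable_heatK_sub _ _).const_mul _

/-- The heat semigroup acts on superpositions of heat kernels by shifting the time. -/
theorem integral_heatK_mul_superposition {α : Type*} [MeasurableSpace α] {μ : Measure α}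
    [SFinite μ] {g r c : α → ℝ} (hg : Measurable g) (hr : Measurable r) (hc : Measurable c)
    (hr0 : ∀ᵐ a ∂μ, 0 < r a) {h : ℝ} (hh : 0 < h) (x : ℝ)
    (hint : Integrable (fun a => g a * heatK (h + r a) (x - c a)) μ) :
    ∫ y, heatK h (x - y) * ∫ a, g a * heatK (r a) (y - c a) ∂μ
      = ∫ a, g a * heatK (h + r a) (x - c a) ∂μ := by
  have key : ∀ a, 0 < r a → ∀ y, heatK h (x - y) * (g a * heatK (r a) (y - c a))
      = g a * (heatK h (x - y) * heatK (r a) (y - c a)) := fun a _ y => by ring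
  have hI : Integrable (Function.uncurry fun (y : ℝ) (a : α) =>
      heatK h (x - y) * (g a * heatK (r a) (y - c a))) (volume.prod μ) := by
    have hm : Measurable (Function.uncurry fun (y : ℝ) (a : α) =>
        heatK h (x - y) * (g a * heatK (r a) (y - c a))) := by
      have h1 : Measurable fun p : ℝ × α => heatK h (x - p.1) :=
        Measurable.heatK measurable_const (by fun_prop)
      have h2 : Measurable fun p : ℝ × α => heatK (r p.2) (p.1 - c p.2) :=
        Measurable.heatK (by fun_prop) (by fun_prop)
      exact h1.mul ((hg.comp measurable_snd).mul h2)
    rw [integrable_prod_iff' hm.aestronglyMeasurable]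
    constructor
    · filter_upwards [hr0] with a ha
      simp only [Function.uncurry]
      simp_rw [key a ha]
      exact (integrable_heatK_mul_heatK hh ha x (c a)).const_mul _
    · refine hint.norm.congr ?_
      filter_upwards [hr0] with a ha
      simp only [Function.uncurry]
      simp_rw [key a ha, norm_mul, Real.norm_of_nonneg (heatK_nonneg _ _)]
      rw [integral_const_mul, integral_heatK_mul_heatK hh ha]
  simp_rw [← integral_const_mul]
  rw [integral_integral_swap hI]
  refine integral_congr_ae ?_
  filter_upwards [hr0] with a ha
  simp_rw [key a ha]
  rw [integral_const_mul, integral_heatK_mul_heatK hh ha]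

theorem intervalIntegrable_inv_sqrt (T : ℝ) :
    IntervalIntegrable (fun r => (√(2 * π * r))⁻¹) volume 0 T := by
  have := (intervalIntegral.intervalIntegrable_rpow' (a := 0) (b := T) (r := -(1/2))
    (by norm_num)).const_mul (√(2 * π))⁻¹
  rcases le_total 0 T with hT | hT
  · refine this.congr fun r hr => ?_
    rw [uIoc_of_le hT] at hr
    rw [Real.sqrt_mul (x := 2 * π) (by positivity) r, mul_inv, Real.rpow_neg hr.1.le, ← Real.sqrt_eq_rpow]
  · refine (intervalIntegrable_const (c := (0 : ℝ))).congr fun r hr => ?_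
    rw [uIoc_of_ge hT] at hr
    have : 2 * π * r ≤ 0 := mul_nonpos_of_nonneg_of_nonpos (by positivity) hr.2
    simp [Real.sqrt_eq_zero_of_nonpos this]

theorem heatK_eq_scale {t : ℝ} (ht : 0 < t) (x : ℝ) :
    heatK t x = (√t)⁻¹ * heatK 1 ((√t)⁻¹ * x) := by
  unfold heatK
  rw [mul_one, Real.sqrt_mul (by positivity), mul_inv, mul_pow, inv_pow, Real.sq_sqrt ht.le]
  have : -x ^ 2 / (2 * t) = -(t⁻¹ * x ^ 2) / (2 * 1) := by field_simp
  rw [this]; ring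

theorem gaussTail_eq_scale {t : ℝ} (ht : 0 < t) (x : ℝ) :
    gaussTail t x = gaussTail 1 ((√t)⁻¹ * x) := by
  unfold gaussTail
  simp_rw [heatK_eq_scale ht]
  rw [integral_const_mul, integral_comp_mul_left_Ioi (heatK 1) x (by positivity : 0 < (√t)⁻¹)]
  have : √t ≠ 0 := by positivity
  simp [this]

theorem hasDerivAt_gaussTail (t x : ℝ) : HasDerivAt (gaussTail t) (-heatK t x) x := by
  have : gaussTail t = fun x => gaussTail t 0 - ∫ y in (0:ℝ)..x, heatK t y := by
    funext x
    unfold gaussTail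
    rw [← intervalIntegral.integral_Ioi_sub_Ioi' (integrable_heatK t).integrableOn
      (integrable_heatK t).integrableOn]
    ring
  rw [this]
  exact ((continuous_heatK t).integral_hasStrictDerivAt 0 x).hasDerivAt.const_sub _

theorem continuous_gaussTail (t : ℝ) : Continuous (gaussTail t) :=
  continuous_iff_continuousAt.2 fun x => (hasDerivAt_gaussTail t x).continuousAt

theorem tendsto_gaussTail_atTop (t : ℝ) : Tendsto (gaussTail t) atTop (𝓝 0) :=
  tendsto_integral_Ioi_zero tendsto_id

theorem hasDerivAt_heatK_space (t x : ℝ) : HasDerivAt (heatK t) (-(x / t) * heatK t x) x := by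
  have h1 : HasDerivAt (fun x : ℝ => -x ^ 2 / (2 * t)) (-(x / t)) x := by
    refine ((hasDerivAt_pow 2 x).fun_neg.div_const (2 * t)).congr_deriv ?_
    rcases eq_or_ne t 0 with rfl | h
    · simp
    · field_simp
      norm_num
  refine (h1.exp.const_mul (√(2 * π * t))⁻¹).congr_deriv ?_
  unfold heatK
  ring

end HeatKernel

section InitialProfile

theorem intervalIntegrable_heatK_time (T y : ℝ) :
    IntervalIntegrable (fun r => heatK r y) volume 0 T := by
  refine (intervalIntegrable_inv_sqrt T).mono_fun
    (Measurable.heatK measurable_id measurable_const).aestronglyMeasurable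
    (Eventually.of_forall fun r => ?_)
  beta_reduce
  rw [Real.norm_of_nonneg (heatK_nonneg _ _), Real.norm_of_nonneg (by positivity)]
  exact heatK_le r y

/-- The occupation density of Brownian motion in closed form. -/
theorem integral_heatK_time {T y : ℝ} (hT : 0 < T) (hy : 0 ≤ y) :
    ∫ r in (0:ℝ)..T, heatK r y = 2 * T * heatK T y - 2 * y * gaussTail T y := by
  set G : ℝ → ℝ := fun r => 2 * √r * heatK 1 ((√r)⁻¹ * y) - 2 * y * gaussTail 1 ((√r)⁻¹ * y)
    with hG
  have hGT : G T = 2 * T * heatK T y - 2 * y * gaussTail T y := by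
    have : √T ≠ 0 := by positivity
    rw [hG, heatK_eq_scale hT, gaussTail_eq_scale hT]
    simp only
    have h2 : T * (√T)⁻¹ = √T := by
      rw [← div_eq_mul_inv, Real.div_sqrt]
    linear_combination (-2 * heatK 1 ((√T)⁻¹ * y)) * h2
  have hder : ∀ r : ℝ, 0 < r → HasDerivAt G (heatK r y) r := by
    intro r hr
    have hq : √r ≠ 0 := by positivity
    have h0 : HasDerivAt (fun r => √r) (1 / (2 * √r)) r := Real.hasDerivAt_sqrt hr.ne'
    have h1 : HasDerivAt (fun r => (√r)⁻¹ * y) (-(1 / (2 * √r)) / √r ^ 2 * y) r :=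
      (h0.fun_inv hq).mul_const y
    have h2 := (hasDerivAt_heatK_space 1 ((√r)⁻¹ * y)).comp r h1
    have h3 := (hasDerivAt_gaussTail 1 ((√r)⁻¹ * y)).comp r h1
    refine (((h0.const_mul 2).mul h2).sub (h3.const_mul (2 * y))).congr_deriv ?_
    rw [heatK_eq_scale hr]
    simp only [Function.comp]
    field_simp
    ring
  have h0 : Tendsto G (𝓝[>] 0) (𝓝 0) := by
    have hs : Tendsto (fun r : ℝ => √r) (𝓝[>] 0) (𝓝 0) := by
      have := (Real.continuous_sqrt.tendsto 0).mono_left (nhdsWithin_le_nhds (s := Ioi 0))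
      simpa using this
    have h1 : Tendsto (fun r : ℝ => 2 * √r * heatK 1 ((√r)⁻¹ * y)) (𝓝[>] 0) (𝓝 0) := by
      refine squeeze_zero (fun r => mul_nonneg (by positivity) (heatK_nonneg _ _))
        (fun r => mul_le_mul_of_nonneg_left (heatK_le 1 _) (by positivity)) ?_
      simpa using (hs.const_mul 2).mul_const (√(2 * π * 1))⁻¹
    have h2 : Tendsto (fun r : ℝ => 2 * y * gaussTail 1 ((√r)⁻¹ * y)) (𝓝[>] 0) (𝓝 0) := by
      rcases hy.eq_or_lt with rfl | hy
      · simp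
      · have hi : Tendsto (fun r : ℝ => (√r)⁻¹) (𝓝[>] 0) atTop := by
          refine tendsto_inv_nhdsGT_zero.comp (tendsto_nhdsWithin_iff.2 ⟨hs, ?_⟩)
          filter_upwards [self_mem_nhdsWithin] with r hr
          exact Real.sqrt_pos.2 hr
        simpa using ((tendsto_gaussTail_atTop 1).comp (hi.atTop_mul_const hy)).const_mul (2 * y)
    simpa using h1.sub h2
  have hfin := intervalIntegral.integral_eq_sub_of_hasDerivAt_of_tendsto hT
    (fun r hr => hder r hr.1) (intervalIntegrable_heatK_time T y) h0
    ((hder T hT).continuousAt.tendsto.mono_left nhdsWithin_le_nhds)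
  rw [hfin, hGT, sub_zero]

theorem Ustst_eq (y : ℝ) : Ustst y
    = 4 * heatK (1 / 2) 0 - 4 * heatK (1 / 2) y + 4 * y * gaussTail (1 / 2) y := by
  have hder : ∀ x ∈ uIcc 0 y, HasDerivAt
      (fun x => 4 * x * gaussTail (1 / 2) x - 4 * heatK (1 / 2) x) (u1 (1 / 2) x) x := by
    intro x _
    refine ((((hasDerivAt_id x).const_mul 4).mul (hasDerivAt_gaussTail (1 / 2) x)).sub
      ((hasDerivAt_heatK_space (1 / 2) x).const_mul 4)).congr_deriv ?_
    simp only [u1, id]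
    ring
  have hcont : Continuous (u1 (1 / 2)) := by
    have h1 := continuous_heatK (1 / 2)
    have h2 := continuous_gaussTail (1 / 2)
    unfold u1
    fun_prop
  unfold Ustst
  rw [intervalIntegral.integral_eq_sub_of_hasDerivAt hder (hcont.intervalIntegrable _ _)]
  ring

theorem continuous_Ustst : Continuous Ustst := by
  rw [funext Ustst_eq]
  have h1 := continuous_heatK (1 / 2)
  have h2 := continuous_gaussTail (1 / 2)
  fun_prop

theorem Ustst_zero : Ustst 0 = 0 := by simp [Ustst]

theorem heatK_half_zero : heatK (1 / 2) 0 = (√π)⁻¹ := by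
  have : 2 * π * (1 / 2) = π := by ring
  simp [heatK, this, -one_div]

/-- The profile at time `1/2` is the constant `4/√π` minus the reflected profile `Ustst`. -/
theorem initial_profile_eq (y : ℝ) :
    2 * heatK (1 / 2) y + ∫ s in Ioc (0:ℝ) (1 / 2), 2 * heatK (1 / 2 - s) y
      = 4 / √π - Ustst |y| := by
  rw [← intervalIntegral.integral_of_le (by norm_num), intervalIntegral.integral_const_mul,
    intervalIntegral.integral_comp_sub_left (fun s => heatK s y), ← heatK_abs]
  simp_rw [← heatK_abs _ y]
  rw [sub_self, sub_zero, integral_heatK_time (by norm_num) (abs_nonneg y), Ustst_eq,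
    heatK_half_zero]
  ring

theorem Ustst_le {y : ℝ} (hy : 0 ≤ y) : Ustst y ≤ 4 / √π := by
  have h := initial_profile_eq y
  rw [abs_of_nonneg hy] at h
  have h1 : 0 ≤ ∫ s in Ioc (0:ℝ) (1 / 2), 2 * heatK (1 / 2 - s) y :=
    integral_nonneg fun s => mul_nonneg zero_le_two (heatK_nonneg _ _)
  linarith [heatK_nonneg (1 / 2) y]

theorem Ustst_nonneg {y : ℝ} (hy : 0 ≤ y) : 0 ≤ Ustst y := by
  refine intervalIntegral.integral_nonneg hy fun w hw => ?_
  have : 0 ≤ gaussTail (1 / 2) w := integral_nonneg fun v => heatK_nonneg _ _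
  have := heatK_nonneg (1 / 2) w
  have := hw.1
  unfold u1
  positivity

end InitialProfile

section MaximumPrinciple

theorem heatK_le_of_abs_le {h δ v : ℝ} (hh : 0 < h) (hδ : δ ^ 2 ≤ v ^ 2) :
    heatK h v ≤ √2 * exp (-(δ ^ 2 / (4 * h))) * heatK (2 * h) v := by
  unfold heatK
  have e1 : √(2 * π * (2 * h)) = √2 * √(2 * π * h) := by
    rw [← Real.sqrt_mul (by norm_num)]; congr 1; ring
  have e2 : -v ^ 2 / (2 * h) = -(v ^ 2 / (4 * h)) + -v ^ 2 / (2 * (2 * h)) := by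
    field_simp; ring
  have h2 : √2 ≠ 0 := by positivity
  have e3 : √2 * exp (-(δ ^ 2 / (4 * h))) * ((√2 * √(2 * π * h))⁻¹ * exp (-v ^ 2 / (2 * (2 * h))))
      = (√(2 * π * h))⁻¹ * (exp (-(δ ^ 2 / (4 * h))) * exp (-v ^ 2 / (2 * (2 * h)))) := by
    field_simp
  rw [e1, e3, e2, Real.exp_add]
  gcongr

theorem heatK_le_exp_mul_inv_sqrt {r T δ v : ℝ} (hr : r ≤ T) (hδ : δ ^ 2 ≤ v ^ 2) :
    heatK r v ≤ exp (-(δ ^ 2 / (2 * T))) * (√(2 * π * r))⁻¹ := by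
  rcases le_or_gt r 0 with h0 | h0
  · rw [heatK_of_nonpos h0]; positivity
  · unfold heatK
    rw [mul_comm, neg_div]
    gcongr

theorem parabolic_maximum_principle {w : ℝ → ℝ} (hw : Continuous w) {a T B : ℝ}
    {H : ℝ → ℝ → ℝ}
    (hcont : ContinuousOn (Function.uncurry H) {p | p.1 ∈ Icc a T ∧ p.2 ≤ w p.1})
    (hmeas : ∀ t ∈ Icc a T, Measurable (H t)) (hB : ∀ t ∈ Icc a T, ∀ x, |H t x| ≤ B)
    (hinit : ∀ x ≤ w a, H a x ≤ 0) (hbdy : ∀ t ∈ Icc a T, H t (w t) ≤ 0)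
    (hdecay : ∀ η > 0, ∃ R, ∀ t ∈ Icc a T, ∀ x ≤ R, H t x ≤ η)
    (hsemi : ∀ t x h, 0 < h → a < t - h → t ≤ T →
      H t x ≤ (∫ y, heatK h (x - y) * H (t - h) y) + ∫ r in (0:ℝ)..h, heatK r (x - w (t - r)))
    {t₀ x₀ : ℝ} (ht₀ : t₀ ∈ Icc a T) (hx₀ : x₀ ≤ w t₀) : H t₀ x₀ ≤ 0 := by
  by_contra! hpos
  set c := H t₀ x₀ with hc
  have haT : a ≤ T := ht₀.1.trans ht₀.2
  obtain ⟨ε, hε, hεc⟩ : ∃ ε > 0, ε * (T - a) ≤ c / 2 := by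
    refine ⟨c / 2 / (T - a + 1), by have := sub_nonneg.2 haT; positivity, ?_⟩
    have h1 : 0 < T - a + 1 := by linarith
    rw [div_mul_eq_mul_div, div_le_iff₀ h1]
    nlinarith
  obtain ⟨R, hR⟩ := hdecay (c / 4) (by positivity)
  obtain ⟨W, hW⟩ := (isCompact_Icc (a := a) (b := T)).bddAbove_image hw.continuousOn
  set K : Set (ℝ × ℝ) := {p | p.1 ∈ Icc a T ∧ p.2 ≤ w p.1} ∩ {p | min R x₀ ≤ p.2} with hKdef
  have hKc : IsCompact K := by
    refine ((isCompact_Icc (a := a) (b := T)).prod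
      (isCompact_Icc (a := min R x₀) (b := W))).of_isClosed_subset
      ?_ ?_
    · refine IsClosed.inter (IsClosed.inter ?_ ?_) ?_
      · exact isClosed_Icc.preimage continuous_fst
      · exact isClosed_le continuous_snd (hw.comp continuous_fst)
      · exact isClosed_le continuous_const continuous_snd
    · rintro ⟨t, x⟩ ⟨⟨h1, h2⟩, h3⟩
      exact ⟨h1, h3, h2.trans (hW (mem_image_of_mem w h1))⟩
  have hmem₀ : (t₀, x₀) ∈ K := ⟨⟨ht₀, hx₀⟩, min_le_right R x₀⟩
  obtain ⟨⟨t₁, x₁⟩, ⟨⟨ht₁, hx₁⟩, hx₁'⟩, hmax⟩ := hKc.exists_isMaxOn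
    (f := fun p => H p.1 p.2 - ε * (p.1 - a)) ⟨(t₀, x₀), hmem₀⟩
    ((hcont.mono inter_subset_left).sub (by fun_prop))
  simp only at ht₁ hx₁
  set M := H t₁ x₁ - ε * (t₁ - a) with hM
  have hM0 : c / 2 ≤ M := by
    have h1 := hmax hmem₀
    have h1 : c - ε * (t₀ - a) ≤ M := h1
    have : ε * (t₀ - a) ≤ ε * (T - a) := by
      have := ht₀.2
      gcongr
    linarith
  have hdom : ∀ t ∈ Icc a T, ∀ x ≤ w t, H t x ≤ M + ε * (t - a) := by
    intro t ht x hx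
    rcases le_or_gt (min R x₀) x with h | h
    · have h1 : H t x - ε * (t - a) ≤ M := hmax (show (t, x) ∈ K from ⟨⟨ht, hx⟩, h⟩)
      linarith
    · have h1 := hR t ht x (h.le.trans (min_le_left _ _))
      have h2 : 0 ≤ ε * (t - a) := mul_nonneg hε.le (sub_nonneg.2 ht.1)
      linarith
  have hsub : 0 ≤ ε * (t₁ - a) := mul_nonneg hε.le (sub_nonneg.2 ht₁.1)
  have hta : a < t₁ := by
    refine lt_of_le_of_ne ht₁.1 fun h => ?_
    subst h
    linarith [hinit x₁ hx₁]
  have hxw : x₁ < w t₁ := by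
    refine lt_of_le_of_ne hx₁ fun h => ?_
    have := hbdy t₁ ht₁
    rw [← h] at this
    linarith
  have hB0 : 0 ≤ B := (abs_nonneg _).trans (hB t₁ ht₁ x₁)
  set δ := (w t₁ - x₁) / 2 with hδ
  have hδ0 : 0 < δ := by rw [hδ]; linarith
  obtain ⟨h₀, hh₀, hw₀⟩ : ∃ h₀ > 0, ∀ r, 0 ≤ r → r < h₀ → x₁ + δ < w (t₁ - r) := by
    have h1 : ∀ᶠ r in 𝓝 (0:ℝ), x₁ + δ < w (t₁ - r) := by
      have h2 : ContinuousAt (fun r => w (t₁ - r)) 0 := by fun_prop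
      refine h2.eventually_const_lt ?_
      simp only [sub_zero]
      linarith
    obtain ⟨h₀, hh₀, h3⟩ := Metric.eventually_nhds_iff.1 h1
    exact ⟨h₀, hh₀, fun r h0 h4 => h3 (by rwa [Real.dist_eq, sub_zero, abs_of_nonneg h0])⟩
  set C := √2 * B + ∫ r in (0:ℝ)..1, (√(2 * π * r))⁻¹ with hC
  have hmain : ∀ h, 0 < h → h < min (min h₀ 1) (t₁ - a) →
      ε * h ≤ C * exp (-(δ ^ 2 / (4 * h))) := by
    intro h hh hlt
    have hlt1 : h < h₀ := hlt.trans_le ((min_le_left _ _).trans (min_le_left _ _))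
    have hlt2 : h < 1 := hlt.trans_le ((min_le_left _ _).trans (min_le_right _ _))
    have hlt3 : h < t₁ - a := hlt.trans_le (min_le_right _ _)
    have hmem : t₁ - h ∈ Icc a T := ⟨by linarith, by linarith [ht₁.2]⟩
    have hs := hsemi t₁ x₁ h hh (by linarith) ht₁.2
    have hL : 0 ≤ M + ε * (t₁ - h - a) := by
      have : 0 ≤ ε * (t₁ - h - a) := mul_nonneg hε.le (by linarith)
      linarith
    have hfirst : ∫ y, heatK h (x₁ - y) * H (t₁ - h) y
        ≤ (M + ε * (t₁ - h - a)) + B * (√2 * exp (-(δ ^ 2 / (4 * h)))) := by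
      have hI : Integrable fun y => (M + ε * (t₁ - h - a)) * heatK h (x₁ - y)
          + B * (√2 * exp (-(δ ^ 2 / (4 * h)))) * heatK (2 * h) (x₁ - y) :=
        ((integrable_heatK_sub _ _).const_mul _).add ((integrable_heatK_sub _ _).const_mul _)
      have hJ : Integrable fun y => heatK h (x₁ - y) * H (t₁ - h) y :=
        (integrable_heatK_sub h x₁).mul_bdd (c := B) (hmeas _ hmem).aestronglyMeasurable
          (Eventually.of_forall fun y => hB _ hmem y)
      refine (integral_mono hJ hI fun y => ?_).trans_eq ?_
      · have hp := heatK_nonneg h (x₁ - y)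
        have hp2 := heatK_nonneg (2 * h) (x₁ - y)
        beta_reduce
        rcases le_or_gt y (w (t₁ - h)) with hy | hy
        · have h1 := hdom _ hmem y hy
          have h2 : 0 ≤ B * (√2 * exp (-(δ ^ 2 / (4 * h)))) * heatK (2 * h) (x₁ - y) := by
            positivity
          nlinarith
        · have h1 : H (t₁ - h) y ≤ B := (le_abs_self _).trans (hB _ hmem y)
          have h2 := hw₀ h hh.le hlt1
          have h3 := heatK_le_of_abs_le (δ := δ) (v := x₁ - y) hh (by nlinarith)
          have h4 : 0 ≤ (M + ε * (t₁ - h - a)) * heatK h (x₁ - y) := by positivity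
          have h5 := mul_le_mul_of_nonneg_left h1 hp
          have h6 := mul_le_mul_of_nonneg_left h3 hB0
          linarith
      · rw [integral_add ((integrable_heatK_sub _ _).const_mul _)
          ((integrable_heatK_sub _ _).const_mul _), integral_const_mul, integral_const_mul,
          integral_heatK_sub hh, integral_heatK_sub (by positivity)]
        ring
    have hsecond : ∫ r in (0:ℝ)..h, heatK r (x₁ - w (t₁ - r))
        ≤ exp (-(δ ^ 2 / (4 * h))) * ∫ r in (0:ℝ)..1, (√(2 * π * r))⁻¹ := by
      have hb : ∀ r ∈ Icc 0 h, heatK r (x₁ - w (t₁ - r))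
          ≤ exp (-(δ ^ 2 / (4 * h))) * (√(2 * π * r))⁻¹ := by
        intro r hr
        have h2 := hw₀ r hr.1 (hr.2.trans_lt hlt1)
        refine (heatK_le_exp_mul_inv_sqrt (T := h) (δ := δ) hr.2 (by nlinarith)).trans ?_
        gcongr
        norm_num
      have hi1 : IntervalIntegrable (fun r => heatK r (x₁ - w (t₁ - r))) volume 0 h := by
        refine (intervalIntegrable_inv_sqrt h).mono_fun
          (Measurable.heatK measurable_id
            (by have := hw.measurable; fun_prop)).aestronglyMeasurable
          (Eventually.of_forall fun r => ?_)
        beta_reduce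
        rw [Real.norm_of_nonneg (heatK_nonneg _ _), Real.norm_of_nonneg (by positivity)]
        exact heatK_le r _
      refine (intervalIntegral.integral_mono_on hh.le hi1
        ((intervalIntegrable_inv_sqrt h).const_mul _) hb).trans ?_
      rw [intervalIntegral.integral_const_mul]
      gcongr
      refine intervalIntegral.integral_mono_interval le_rfl hh.le hlt2.le
        (Eventually.of_forall fun r => ?_) (intervalIntegrable_inv_sqrt 1)
      simp only [Pi.zero_apply]
      positivity
    rw [hC]
    have e : M + ε * (t₁ - a) = H t₁ x₁ := by rw [hM]; ring
    nlinarith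
  have hC0 : 0 ≤ C := by
    have : 0 ≤ ∫ r in (0:ℝ)..1, (√(2 * π * r))⁻¹ :=
      intervalIntegral.integral_nonneg zero_le_one fun r _ => by positivity
    positivity
  have hlin : ∀ᶠ h in 𝓝[>] (0:ℝ), ε ≤ C * 32 / δ ^ 4 * h := by
    have hev : ∀ᶠ h in 𝓝[>] (0:ℝ), h < min (min h₀ 1) (t₁ - a) :=
      nhdsWithin_le_nhds (eventually_lt_nhds (lt_min (lt_min hh₀ one_pos) (sub_pos.2 hta)))
    filter_upwards [hev, self_mem_nhdsWithin] with h h1 h2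
    have h2 : 0 < h := h2
    have h3 := hmain h h2 h1
    have hu : 0 < δ ^ 2 / (4 * h) := by positivity
    have h4 : exp (-(δ ^ 2 / (4 * h))) ≤ 32 * h ^ 2 / δ ^ 4 := by
      have h5 := Real.quadratic_le_exp_of_nonneg hu.le
      rw [Real.exp_neg]
      have h6 : (δ ^ 2 / (4 * h)) ^ 2 / 2 ≤ exp (δ ^ 2 / (4 * h)) := by linarith
      refine (inv_anti₀ (by positivity) h6).trans_eq ?_
      field_simp
      norm_num
    have h7 : ε * h ≤ C * (32 * h ^ 2 / δ ^ 4) := h3.trans (by gcongr)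
    have h8 : C * (32 * h ^ 2 / δ ^ 4) = (C * 32 / δ ^ 4 * h) * h := by ring
    rw [h8] at h7
    exact le_of_mul_le_mul_right h7 h2
  have hlim : Tendsto (fun h : ℝ => C * 32 / δ ^ 4 * h) (𝓝[>] 0) (𝓝 0) := by
    have h1 : Continuous fun h : ℝ => C * 32 / δ ^ 4 * h := by fun_prop
    simpa using (h1.tendsto 0).mono_left (nhdsWithin_le_nhds (s := Ioi 0))
  exact absurd (ge_of_tendsto hlim hlin) (not_le.2 hε)

end MaximumPrinciple

section Potentials

/-- The heat flow started at time `1/2` from the profile `Ustst` on the positive half-line. -/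
noncomputable def profileFlow (t x : ℝ) : ℝ :=
  ∫ v, heatK 1 v * Ustst (max (x + √(t - 1 / 2) * v) 0)

/-- The heat potential of a unit source moving along `w` since time `1/2`. -/
noncomputable def sourceFlow (w : ℝ → ℝ) (t x : ℝ) : ℝ :=
  ∫ s in (1 / 2 : ℝ)..t, heatK (t - s) (x - w s)

theorem abs_Ustst_max_le (y : ℝ) : |Ustst (max y 0)| ≤ 4 / √π := by
  rw [abs_of_nonneg (Ustst_nonneg (le_max_right _ _))]
  exact Ustst_le (le_max_right _ _)

theorem continuous_profileFlow : Continuous (Function.uncurry profileFlow) := by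
  have hU := continuous_Ustst
  have hk := continuous_heatK 1
  unfold profileFlow Function.uncurry
  refine continuous_of_dominated (bound := fun v => heatK 1 v * (4 / √π))
    (fun p => Continuous.aestronglyMeasurable (by fun_prop))
    (fun p => Eventually.of_forall fun v => ?_) ((integrable_heatK 1).mul_const _)
    (Eventually.of_forall fun v => by fun_prop)
  rw [norm_mul, Real.norm_of_nonneg (heatK_nonneg _ _)]
  exact mul_le_mul_of_nonneg_left (abs_Ustst_max_le _) (heatK_nonneg _ _)

theorem abs_profileFlow_le (t x : ℝ) : |profileFlow t x| ≤ 4 / √π := by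
  have h := norm_integral_le_of_norm_le (μ := volume)
    (f := fun v => heatK 1 v * Ustst (max (x + √(t - 1 / 2) * v) 0))
    ((integrable_heatK 1).mul_const (4 / √π)) (Eventually.of_forall fun v => by
      rw [norm_mul, Real.norm_of_nonneg (heatK_nonneg _ _)]
      exact mul_le_mul_of_nonneg_left (abs_Ustst_max_le _) (heatK_nonneg _ _))
  rwa [integral_mul_const, integral_heatK one_pos, one_mul] at h

theorem profileFlow_half {x : ℝ} (hx : x ≤ 0) : profileFlow (1 / 2) x = 0 := by
  simp [profileFlow, Ustst_zero, hx]

theorem profileFlow_eq {t : ℝ} (ht : 1 / 2 < t) (x : ℝ) :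
    profileFlow t x = ∫ y in Ioi (0:ℝ), Ustst y * heatK (t - 1 / 2) (x - y) := by
  have hτ : 0 < t - 1 / 2 := sub_pos.2 ht
  have hq : 0 < √(t - 1 / 2) := by positivity
  have h1 : ∫ y in Ioi (0:ℝ), Ustst y * heatK (t - 1 / 2) (x - y)
      = ∫ y, Ustst (max y 0) * heatK (t - 1 / 2) (x - y) := by
    rw [← integral_indicator measurableSet_Ioi]
    congr 1 with y
    rcases le_or_gt y 0 with hy | hy
    · rw [indicator_of_notMem (by simpa using hy), max_eq_right hy, Ustst_zero, zero_mul]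
    · rw [indicator_of_mem (by simpa using hy), max_eq_left hy.le]
  rw [h1, ← integral_add_left_eq_self _ x]
  have h2 := Measure.integral_comp_mul_left
    (fun y => Ustst (max (x + y) 0) * heatK (t - 1 / 2) (x - (x + y))) (√(t - 1 / 2))
  rw [abs_of_pos (inv_pos.2 hq), smul_eq_mul, eq_inv_mul_iff_mul_eq₀ hq.ne'] at h2
  rw [← h2, ← integral_const_mul]
  unfold profileFlow
  congr 1 with v
  rw [sub_add_cancel_left, heatK_neg, heatK_eq_scale hτ, inv_mul_cancel_left₀ hq.ne']
  have hne := hq.ne'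
  generalize √(t - 1 / 2) = q at *
  field_simp

theorem integral_heatK_mul_profileFlow {t h : ℝ} (hh : 0 < h) (ht : 1 / 2 < t - h) (x : ℝ) :
    ∫ y, heatK h (x - y) * profileFlow (t - h) y = profileFlow t x := by
  simp_rw [profileFlow_eq ht]
  rw [profileFlow_eq (by linarith)]
  have e : t - 1 / 2 = h + (t - h - 1 / 2) := by ring
  rw [e]
  refine integral_heatK_mul_superposition (r := fun _ => t - h - 1 / 2) (c := id)
    continuous_Ustst.measurable measurable_const measurable_id
    (Eventually.of_forall fun _ => sub_pos.2 ht) hh x ?_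
  refine (integrable_heatK_sub _ _).integrableOn.bdd_mul (c := 4 / √π)
    continuous_Ustst.aestronglyMeasurable ?_
  filter_upwards [ae_restrict_mem measurableSet_Ioi] with y hy
  rw [Real.norm_of_nonneg (Ustst_nonneg (le_of_lt hy))]
  exact Ustst_le (le_of_lt hy)

theorem profileFlow_le_exp {t T x : ℝ} (ht : t ∈ Icc (1 / 2) T) (hx : x ≤ 0) :
    |profileFlow t x| ≤ 4 / √π * exp (-(x ^ 2 / (2 * T))) := by
  rcases ht.1.eq_or_lt with rfl | h
  · rw [profileFlow_half hx, abs_zero]; positivity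
  have hτ : 0 < t - 1 / 2 := sub_pos.2 h
  rw [profileFlow_eq h]
  have hi := (integrable_heatK (t - 1 / 2)).integrableOn (s := Ioi 0)
  have h1 : ‖∫ y in Ioi (0:ℝ), Ustst y * heatK (t - 1 / 2) (x - y)‖
      ≤ ∫ y in Ioi (0:ℝ), 4 / √π * exp (-(x ^ 2 / (2 * T))) * heatK (t - 1 / 2) y := by
    refine norm_integral_le_of_norm_le (hi.const_mul _) ?_
    filter_upwards [ae_restrict_mem measurableSet_Ioi] with y hy
    have hy : 0 < y := hy
    rw [norm_mul, Real.norm_of_nonneg (Ustst_nonneg hy.le), Real.norm_of_nonneg (heatK_nonneg _ _),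
      mul_assoc]
    refine mul_le_mul (Ustst_le hy.le) ?_ (heatK_nonneg _ _) (by positivity)
    unfold heatK
    rw [mul_left_comm, ← Real.exp_add]
    gcongr
    have e1 : x ^ 2 / (2 * T) ≤ x ^ 2 / (2 * (t - 1 / 2)) := by
      have := ht.2
      gcongr
      linarith
    have e2 : -(x - y) ^ 2 / (2 * (t - 1 / 2)) ≤ -(x ^ 2 + y ^ 2) / (2 * (t - 1 / 2)) := by
      gcongr
      nlinarith
    have e3 : -(x ^ 2 + y ^ 2) / (2 * (t - 1 / 2))
      = -(x ^ 2 / (2 * (t - 1 / 2))) + -y ^ 2 / (2 * (t - 1 / 2)) := by ring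
    linarith
  refine h1.trans ?_
  rw [integral_const_mul]
  refine mul_le_of_le_one_right (by positivity) ?_
  exact (setIntegral_le_integral (integrable_heatK _)
    (Eventually.of_forall fun y => heatK_nonneg _ _)).trans_eq (integral_heatK hτ)

variable {w : ℝ → ℝ}

theorem intervalIntegrable_source (hw : Continuous w) (t a b x : ℝ) :
    IntervalIntegrable (fun s => heatK (t - s) (x - w s)) volume a b := by
  have hm : Measurable fun s => heatK (t - s) (x - w s) := by
    have := hw.measurable
    exact Measurable.heatK (by fun_prop) (by fun_prop)
  have h : ∀ c, IntervalIntegrable (fun s => heatK (t - s) (x - w s)) volume t c := fun c => by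
    have := (intervalIntegrable_inv_sqrt (t - c)).comp_sub_left t
    rw [sub_zero, sub_sub_cancel] at this
    refine this.mono_fun hm.aestronglyMeasurable (Eventually.of_forall fun s => ?_)
    beta_reduce
    rw [Real.norm_of_nonneg (heatK_nonneg _ _), Real.norm_of_nonneg (by positivity)]
    exact heatK_le _ _
  exact (h a).symm.trans (h b)

theorem sourceFlow_eq_integral_indicator {t T : ℝ} (ht : t ∈ Icc (1 / 2) T) (x : ℝ) :
    sourceFlow w t x
      = ∫ r in (0:ℝ)..T, (Iio (t - 1 / 2)).indicator (fun r => heatK r (x - w (t - r))) r := by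
  have hT : 0 ≤ T := by linarith [ht.1, ht.2]
  rw [intervalIntegral.integral_of_le hT, setIntegral_indicator measurableSet_Iio]
  have hs : Ioc 0 T ∩ Iio (t - 1 / 2) = Ioo 0 (t - 1 / 2) := by
    ext r
    simp only [mem_inter_iff, mem_Ioc, mem_Iio, mem_Ioo]
    exact ⟨fun h => ⟨h.1.1, h.2⟩, fun h => ⟨⟨h.1, by linarith [h.2, ht.2]⟩, h.2⟩⟩
  rw [hs, ← integral_Ioc_eq_integral_Ioo, ← intervalIntegral.integral_of_le (by linarith [ht.1])]
  have h := intervalIntegral.integral_comp_sub_left (a := 1 / 2) (b := t)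
    (fun r => heatK r (x - w (t - r))) t
  rw [sub_self] at h
  rw [← h]
  simp only [sub_sub_cancel, sourceFlow]

theorem continuousOn_sourceFlow (hw : Continuous w) (T : ℝ) :
    ContinuousOn (Function.uncurry (sourceFlow w)) (Icc (1 / 2) T ×ˢ univ) := by
  set F : ℝ × ℝ → ℝ → ℝ := fun p r =>
    (Iio (p.1 - 1 / 2)).indicator (fun r => heatK r (p.2 - w (p.1 - r))) r with hF
  have hcont : Continuous fun p : ℝ × ℝ => ∫ r in (0:ℝ)..T, F p r := by
    rw [continuous_iff_continuousAt]
    intro p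
    refine intervalIntegral.continuousAt_of_dominated_interval
      (bound := fun r => (√(2 * π * r))⁻¹) (Eventually.of_forall fun q => ?_)
      (Eventually.of_forall fun q => Eventually.of_forall fun r _ => ?_)
      (intervalIntegrable_inv_sqrt T) ?_
    · have := hw.measurable
      exact ((Measurable.heatK measurable_id (by fun_prop)).indicator
        measurableSet_Iio).aestronglyMeasurable
    · refine (norm_indicator_le_norm_self _ _).trans ?_
      rw [Real.norm_of_nonneg (heatK_nonneg _ _)]
      exact heatK_le _ _
    · have h1 : ∀ᵐ r : ℝ, r ≠ p.1 - 1 / 2 := Measure.ae_ne volume _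
      filter_upwards [h1] with r hr _
      rcases lt_or_gt_of_ne hr with hr | hr
      · have h2 : Continuous fun q : ℝ × ℝ => heatK r (q.2 - w (q.1 - r)) :=
          (continuous_heatK r).comp (by fun_prop)
        refine h2.continuousAt.congr ?_
        have h3 : ∀ᶠ q : ℝ × ℝ in 𝓝 p, r < q.1 - 1 / 2 :=
          (by fun_prop : ContinuousAt (fun q : ℝ × ℝ => q.1 - 1 / 2) p).eventually_const_lt hr
        filter_upwards [h3] with q hq
        rw [hF]
        simp only
        rw [indicator_of_mem (by exact hq)]
      · refine (continuousAt_const (y := (0:ℝ))).congr ?_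
        have h3 : ∀ᶠ q : ℝ × ℝ in 𝓝 p, q.1 - 1 / 2 < r :=
          (by fun_prop : ContinuousAt (fun q : ℝ × ℝ => q.1 - 1 / 2) p).eventually_lt_const hr
        filter_upwards [h3] with q hq
        rw [hF]
        simp only
        rw [indicator_of_notMem (by simpa using hq.le)]
  refine hcont.continuousOn.congr ?_
  rintro ⟨t, x⟩ ⟨ht, -⟩
  exact sourceFlow_eq_integral_indicator ht x

theorem abs_sourceFlow_le {t T δ x : ℝ} (hw : Continuous w) (ht : t ∈ Icc (1 / 2) T)
    (hδ : ∀ s ∈ Icc (1 / 2) t, δ ^ 2 ≤ (x - w s) ^ 2) :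
    |sourceFlow w t x| ≤ exp (-(δ ^ 2 / (2 * T))) * ∫ r in (0:ℝ)..T, (√(2 * π * r))⁻¹ := by
  have h0 : 0 ≤ sourceFlow w t x :=
    intervalIntegral.integral_nonneg ht.1 fun s _ => heatK_nonneg _ _
  have h1 : IntervalIntegrable (fun s => (√(2 * π * (t - s)))⁻¹) volume (1 / 2) t := by
    have := (intervalIntegrable_inv_sqrt (t - 1 / 2)).comp_sub_left t
    rw [sub_zero, sub_sub_cancel] at this
    exact this.symm
  rw [abs_of_nonneg h0]
  refine (intervalIntegral.integral_mono_on ht.1 (intervalIntegrable_source hw t _ _ x)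
    (h1.const_mul (exp (-(δ ^ 2 / (2 * T))))) fun s hs => heatK_le_exp_mul_inv_sqrt
      (by linarith [hs.1, ht.2]) (hδ s hs)).trans ?_
  rw [intervalIntegral.integral_const_mul,
    intervalIntegral.integral_comp_sub_left (fun r => (√(2 * π * r))⁻¹), sub_self]
  gcongr
  exact intervalIntegral.integral_mono_interval le_rfl (by linarith [ht.1]) (by linarith [ht.2])
    (Eventually.of_forall fun r => by simp only [Pi.zero_apply]; positivity)
    (intervalIntegrable_inv_sqrt T)

theorem sourceFlow_eq_integral_add {t h : ℝ} (hw : Continuous w) (hh : 0 < h)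
    (ht : 1 / 2 < t - h) (x : ℝ) :
    sourceFlow w t x = (∫ y, heatK h (x - y) * sourceFlow w (t - h) y)
      + ∫ r in (0:ℝ)..h, heatK r (x - w (t - r)) := by
  have h1 : ∫ r in (0:ℝ)..h, heatK r (x - w (t - r))
      = ∫ s in (t - h)..t, heatK (t - s) (x - w s) := by
    have := intervalIntegral.integral_comp_sub_left (a := t - h) (b := t)
      (fun r => heatK r (x - w (t - r))) t
    rw [sub_self, sub_sub_cancel] at this
    rw [← this]
    simp only [sub_sub_cancel]
  have h2 : ∫ y, heatK h (x - y) * sourceFlow w (t - h) y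
      = ∫ s in (1 / 2 : ℝ)..(t - h), heatK (t - s) (x - w s) := by
    have hm := hw.measurable
    have := integral_heatK_mul_superposition (μ := volume.restrict (Ioc (1 / 2) (t - h)))
      (g := fun _ => 1) (r := fun s => t - h - s) (c := w) measurable_const (by fun_prop) hm
      (by
        rw [← restrict_Ioo_eq_restrict_Ioc]
        filter_upwards [ae_restrict_mem measurableSet_Ioo] with s hs
        linarith [hs.2]) hh x
      (by
        have e : ∀ s, h + (t - h - s) = t - s := fun s => by ring
        simp only [e, one_mul]
        exact (intervalIntegrable_source hw t _ _ x).1)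
    have e : ∀ s, h + (t - h - s) = t - s := fun s => by ring
    simp only [e, one_mul, ← intervalIntegral.integral_of_le ht.le] at this
    exact this
  rw [h1, h2, sourceFlow]
  exact (intervalIntegral.integral_add_adjacent_intervals (intervalIntegrable_source hw t _ _ x)
    (intervalIntegrable_source hw t _ _ x)).symm

theorem integrable_heatK_mul_slice {h T t B x : ℝ} {H : ℝ → ℝ → ℝ} (ht : t ∈ Icc (1 / 2) T)
    (hH : ContinuousOn (Function.uncurry H) (Icc (1 / 2) T ×ˢ univ)) (hB : ∀ y, |H t y| ≤ B) :
    Integrable fun y => heatK h (x - y) * H t y := by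
  have hc : Continuous (H t) := by
    rw [← continuousOn_univ]
    exact hH.comp (f := fun y => (t, y)) (by fun_prop) fun y _ => ⟨ht, mem_univ _⟩
  exact (integrable_heatK_sub h x).mul_bdd (c := B) hc.aestronglyMeasurable
    (Eventually.of_forall hB)

/-- If the two potentials agree along the free boundary, they agree to the left of it. -/
theorem profileFlow_eq_sourceFlow (hw : Continuous w) (hw0 : ∀ s, 0 ≤ w s) (hwh : w (1 / 2) = 0)
    (hbdy : ∀ t > 1 / 2, profileFlow t (w t) = sourceFlow w t (w t)) {t x : ℝ} (ht : 1 / 2 ≤ t)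
    (hx : x ≤ w t) : profileFlow t x = sourceFlow w t x := by
  set I := ∫ r in (0:ℝ)..t, (√(2 * π * r))⁻¹ with hI
  have hI0 : 0 ≤ I :=
    intervalIntegral.integral_nonneg (by linarith) fun r _ => by positivity
  have hS : ∀ s ∈ Icc (1 / 2) t, ∀ y, |sourceFlow w s y| ≤ I := fun s hs y => by
    have := abs_sourceFlow_le (δ := 0) (x := y) hw hs
      (fun _ _ => by rw [zero_pow two_ne_zero]; exact sq_nonneg _)
    simpa using this
  have hcA := (continuous_profileFlow.continuousOn (s := Icc (1 / 2) t ×ˢ univ))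
  have hcS := continuousOn_sourceFlow hw t
  have hinit : ∀ y ≤ w (1 / 2), profileFlow (1 / 2) y - sourceFlow w (1 / 2) y = 0 := by
    intro y hy
    rw [hwh] at hy
    rw [profileFlow_half hy, sourceFlow, intervalIntegral.integral_same, sub_zero]
  have hbd : ∀ s ∈ Icc (1 / 2) t, profileFlow s (w s) - sourceFlow w s (w s) = 0 := by
    intro s hs
    rcases hs.1.eq_or_lt with rfl | h
    · exact hinit _ le_rfl
    · rw [hbdy s h, sub_self]
  have hdecay : ∀ η > 0, ∃ R, ∀ s ∈ Icc (1 / 2) t, ∀ y ≤ R,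
      |profileFlow s y - sourceFlow w s y| ≤ η := by
    intro η hη
    have hlim : Tendsto (fun y : ℝ => (4 / √π + I) * exp (-(y ^ 2 / (2 * t)))) atBot (𝓝 0) := by
      have h1 : Tendsto (fun y : ℝ => y ^ 2 / (2 * t)) atBot atTop := by
        refine Tendsto.atTop_div_const (by linarith) ?_
        simpa [Function.comp_def] using
        (tendsto_pow_atTop (α := ℝ) two_ne_zero).comp tendsto_neg_atBot_atTop
      simpa using (Real.tendsto_exp_neg_atTop_nhds_zero.comp h1).const_mul (4 / √π + I)
    obtain ⟨R, hR⟩ := eventually_atBot.1 (hlim.eventually_le_const hη)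
    refine ⟨min R 0, fun s hs y hy => ?_⟩
    have hy0 : y ≤ 0 := hy.trans (min_le_right _ _)
    have h1 := hR y (hy.trans (min_le_left _ _))
    have h2 := profileFlow_le_exp hs hy0
    have h3 := abs_sourceFlow_le (δ := y) (x := y) hw hs
      (fun r _ => by nlinarith [hw0 r])
    have h4 := abs_sub (profileFlow s y) (sourceFlow w s y)
    linarith
  have hsemi : ∀ s y h, 0 < h → 1 / 2 < s - h → s ≤ t →
      profileFlow s y - sourceFlow w s y
        = (∫ u, heatK h (y - u) * (profileFlow (s - h) u - sourceFlow w (s - h) u))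
          - ∫ r in (0:ℝ)..h, heatK r (y - w (s - r)) := by
    intro s y h hh hs hst
    have hmem : s - h ∈ Icc (1 / 2) t := ⟨hs.le, by linarith⟩
    simp_rw [mul_sub]
    rw [integral_sub (integrable_heatK_mul_slice hmem hcA (abs_profileFlow_le _))
      (integrable_heatK_mul_slice hmem hcS (hS _ hmem)),
      integral_heatK_mul_profileFlow hh hs, sourceFlow_eq_integral_add hw hh hs y]
    ring
  have hnn : ∀ s y h, 0 < h → 0 ≤ ∫ r in (0:ℝ)..h, heatK r (y - w (s - r)) := fun s y h hh =>
    intervalIntegral.integral_nonneg hh.le fun r _ => heatK_nonneg _ _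
  have hsubset : {p : ℝ × ℝ | p.1 ∈ Icc (1 / 2) t ∧ p.2 ≤ w p.1} ⊆ Icc (1 / 2) t ×ˢ univ :=
    fun p hp => ⟨hp.1, mem_univ _⟩
  have hmeas : ∀ s ∈ Icc (1 / 2) t,
      Measurable fun y => profileFlow s y - sourceFlow w s y := by
    intro s hs
    refine Continuous.measurable ?_
    rw [← continuousOn_univ]
    exact (hcA.sub hcS).comp (f := fun y => (s, y)) (by fun_prop) fun y _ => ⟨hs, mem_univ _⟩
  have hB : ∀ s ∈ Icc (1 / 2) t, ∀ y, |profileFlow s y - sourceFlow w s y| ≤ 4 / √π + I :=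
    fun s hs y => (abs_sub _ _).trans (add_le_add (abs_profileFlow_le s y) (hS s hs y))
  have hmem : t ∈ Icc (1 / 2) t := ⟨ht, le_rfl⟩
  have h1 := parabolic_maximum_principle (H := fun s y => profileFlow s y - sourceFlow w s y)
    hw ((hcA.sub hcS).mono hsubset) hmeas hB (fun y hy => (hinit y hy).le)
    (fun s hs => (hbd s hs).le)
    (fun η hη => (hdecay η hη).imp fun R hR s hs y hy => (le_abs_self _).trans (hR s hs y hy))
    (fun s y h hh hs hst => by linarith [hsemi s y h hh hs hst, hnn s y h hh]) hmem hx
  have h2 := parabolic_maximum_principle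
    (H := fun s y => -(profileFlow s y - sourceFlow w s y))
    hw ((hcA.sub hcS).mono hsubset).neg (fun s hs => (hmeas s hs).neg)
    (fun s hs y => (abs_neg _).trans_le (hB s hs y))
    (fun y hy => by rw [hinit y hy, neg_zero])
    (fun s hs => by rw [hbd s hs, neg_zero])
    (fun η hη => (hdecay η hη).imp fun R hR s hs y hy => (neg_le_abs _).trans (hR s hs y hy))
    (fun s y h hh hs hst => by
      simp_rw [mul_neg]
      rw [integral_neg]
      linarith [hsemi s y h hh hs hst]) hmem hx
  linarith

end Potentials

section Conservation

theorem integral_heatK_mul_Ustst_abs {t : ℝ} (ht : 1 / 2 < t) (x : ℝ) :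
    ∫ y, heatK (t - 1 / 2) (x - y) * Ustst |y| = profileFlow t x + profileFlow t (-x) := by
  have hc : Continuous fun y => Ustst |y| := by
    have := continuous_Ustst
    fun_prop
  have hi : Integrable fun y => heatK (t - 1 / 2) (x - y) * Ustst |y| :=
    (integrable_heatK_sub _ x).mul_bdd (c := 4 / √π) hc.aestronglyMeasurable
      (Eventually.of_forall fun y => by
        rw [Real.norm_of_nonneg (Ustst_nonneg (abs_nonneg y))]
        exact Ustst_le (abs_nonneg y))
  rw [← intervalIntegral.integral_Iic_add_Ioi (b := 0) hi.integrableOn hi.integrableOn,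
    profileFlow_eq ht, profileFlow_eq ht, add_comm]
  congr 1
  · refine setIntegral_congr_fun measurableSet_Ioi fun y hy => ?_
    rw [abs_of_pos hy, mul_comm]
  · rw [show Iic (0:ℝ) = Iic (-0) by rw [neg_zero], ← integral_comp_neg_Ioi]
    refine setIntegral_congr_fun measurableSet_Ioi fun y hy => ?_
    have hy : 0 < y := hy
    rw [abs_neg, abs_of_pos hy, mul_comm, ← heatK_neg _ (-x - y)]
    congr 2
    ring

/-- The free evolution up to time `t` of a point source and a boundary source at the origin. -/
theorem free_evolution_eq {t : ℝ} (ht : 1 / 2 < t) (x : ℝ) :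
    2 * heatK t x + ∫ s in (0:ℝ)..(1 / 2), 2 * heatK (t - s) x
      = 4 / √π - profileFlow t x - profileFlow t (-x) := by
  have hτ : 0 < t - 1 / 2 := sub_pos.2 ht
  have hc : Continuous fun y => Ustst |y| := by
    have := continuous_Ustst
    fun_prop
  have hi1 : Integrable fun y => heatK (t - 1 / 2) (x - y) * (2 * heatK (1 / 2) y) := by
    have := (integrable_heatK_mul_heatK hτ (by norm_num : (0:ℝ) < 1 / 2) x 0).const_mul 2
    refine this.congr (Eventually.of_forall fun y => ?_)
    simp only [sub_zero]
    ring
  have hi2 : Integrable fun y => heatK (t - 1 / 2) (x - y) * (4 / √π) :=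
    (integrable_heatK_sub _ x).mul_const _
  have hi3 : Integrable fun y => heatK (t - 1 / 2) (x - y) * Ustst |y| :=
    (integrable_heatK_sub _ x).mul_bdd (c := 4 / √π) hc.aestronglyMeasurable
      (Eventually.of_forall fun y => by
        rw [Real.norm_of_nonneg (Ustst_nonneg (abs_nonneg y))]
        exact Ustst_le (abs_nonneg y))
  have hi4 : Integrable fun y => heatK (t - 1 / 2) (x - y) * (4 / √π)
      - heatK (t - 1 / 2) (x - y) * Ustst |y| := hi2.sub hi3
  have hsup : ∫ y, heatK (t - 1 / 2) (x - y) * ∫ s in Ioc (0:ℝ) (1 / 2), 2 * heatK (1 / 2 - s) y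
      = ∫ s in Ioc (0:ℝ) (1 / 2), 2 * heatK (t - s) x := by
    have e : ∀ s : ℝ, t - 1 / 2 + (1 / 2 - s) = t - s := fun s => by ring
    have := integral_heatK_mul_superposition (μ := volume.restrict (Ioc (0:ℝ) (1 / 2)))
      (g := fun _ => 2) (r := fun s => 1 / 2 - s) (c := fun _ => 0) measurable_const
      (by fun_prop) measurable_const
      (by
        rw [← restrict_Ioo_eq_restrict_Ioc]
        filter_upwards [ae_restrict_mem measurableSet_Ioo] with s hs
        exact sub_pos.2 hs.2) hτ x
      (by
        simp only [e]
        exact ((intervalIntegrable_source (w := fun _ => 0) continuous_const t 0 (1 / 2) x).1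
          ).const_mul 2)
    simpa only [e, sub_zero] using this
  have hpoint : ∫ y, heatK (t - 1 / 2) (x - y) * (2 * heatK (1 / 2) y) = 2 * heatK t x := by
    have := integral_heatK_mul_heatK hτ (by norm_num : (0:ℝ) < 1 / 2) x 0
    simp only [sub_zero, sub_add_cancel] at this
    rw [← this, ← integral_const_mul]
    congr 1 with y
    ring
  have hprof : ∀ y, heatK (t - 1 / 2) (x - y)
      * ∫ s in Ioc (0:ℝ) (1 / 2), 2 * heatK (1 / 2 - s) y
      = heatK (t - 1 / 2) (x - y) * (4 / √π) - heatK (t - 1 / 2) (x - y) * Ustst |y|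
        - heatK (t - 1 / 2) (x - y) * (2 * heatK (1 / 2) y) := fun y => by
    linear_combination heatK (t - 1 / 2) (x - y) * initial_profile_eq y
  rw [intervalIntegral.integral_of_le (by norm_num), ← hsup]
  simp_rw [hprof]
  rw [integral_sub hi4 hi1, integral_sub hi2 hi3, hpoint,
    integral_heatK_mul_Ustst_abs ht, integral_mul_const, integral_heatK_sub hτ]
  ring

end Conservation

/-- Conservation of particles in the hydrodynamic limit: if `z` is a continuous nondecreasing
solution on `[1/2,∞)` of the Stefan integral equation with `z(1/2) = 0`, extended by
`z(s) = 0` for `0 ≤ s ≤ 1/2`, and `U*(t,x) := 2p(t,x) + ∫₀ᵗ p_N(t-s, z(s), x) ds`, then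
`U*(t, z(t)) = 4/√π` for every `t ≥ 1/2`. -/
theorem hydrodynamic_conservation_of_particles (z : ℝ → ℝ)
    (hzext : ∀ s : ℝ, 0 ≤ s → s ≤ 1/2 → z s = 0)
    (hzc : ContinuousOn z (Set.Ici (1/2 : ℝ)))
    (hzm : MonotoneOn z (Set.Ici (1/2 : ℝ)))
    (hzeq : ∀ t > (1/2 : ℝ),
      (∫ y in Set.Ioi (0:ℝ), heatK (t - 1/2) (z t - y) * Ustst y)
        = ∫ s in (1/2 : ℝ)..t, heatK (t - s) (z t - z s)) :
    ∀ t ≥ (1/2 : ℝ),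
      2 * heatK t (z t) + (∫ s in (0:ℝ)..t, heatKN (t - s) (z s) (z t))
        = 4 / Real.sqrt Real.pi := by
  intro t ht
  set w : ℝ → ℝ := fun s => z (max s (1 / 2)) with hwdef
  have hw : Continuous w :=
    hzc.comp_continuous (by fun_prop) fun s => mem_Ici.2 (le_max_right _ _)
  have hz0 : z (1 / 2) = 0 := hzext _ (by norm_num) le_rfl
  have hwz : ∀ s, 1 / 2 ≤ s → w s = z s := fun s hs => by simp only [hwdef, max_eq_left hs]
  have hwh : w (1 / 2) = 0 := by rw [hwz _ le_rfl, hz0]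
  have hw0 : ∀ s, 0 ≤ w s := fun s => by
    rw [← hz0]
    exact hzm self_mem_Ici (mem_Ici.2 (le_max_right _ _)) (le_max_right _ _)
  have hleft : ∀ x, ∫ s in (0:ℝ)..(1 / 2), heatKN (t - s) (z s) x
      = ∫ s in (0:ℝ)..(1 / 2), 2 * heatK (t - s) x := fun x => by
    refine intervalIntegral.integral_congr fun s hs => ?_
    rw [uIcc_of_le (by norm_num)] at hs
    simp only [heatKN, hzext s hs.1 hs.2, zero_sub, zero_add, heatK_neg]
    ring
  rcases ht.eq_or_lt with rfl | h
  · rw [hleft, hz0, intervalIntegral.integral_of_le (by norm_num), initial_profile_eq, abs_zero,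
      Ustst_zero, sub_zero]
  have hsource : ∀ u > 1 / 2, ∀ x, sourceFlow w u x
      = ∫ s in (1 / 2 : ℝ)..u, heatK (u - s) (x - z s) := fun u hu x => by
    refine intervalIntegral.integral_congr fun s hs => ?_
    rw [uIcc_of_le hu.le] at hs
    simp only [hwz s hs.1]
  have hbdy : ∀ u > 1 / 2, profileFlow u (w u) = sourceFlow w u (w u) := fun u hu => by
    rw [hsource u hu, hwz u hu.le, ← hzeq u hu, profileFlow_eq hu]
    simp_rw [mul_comm]
  have hreflect := profileFlow_eq_sourceFlow hw hw0 hwh hbdy ht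
    (show -w t ≤ w t by linarith [hw0 t])
  have hK : ∀ s, heatKN (t - s) (w s) (w t)
      = heatK (t - s) (w t - w s) + heatK (t - s) (-w t - w s) := fun s => by
    rw [heatKN, heatK_sub_comm, ← heatK_neg _ (-w t - w s)]
    congr 2
    ring
  have hright : ∫ s in (1 / 2 : ℝ)..t, heatKN (t - s) (z s) (w t)
      = sourceFlow w t (w t) + sourceFlow w t (-w t) := by
    rw [sourceFlow, sourceFlow, ← intervalIntegral.integral_add
      (intervalIntegrable_source hw _ _ _ _) (intervalIntegrable_source hw _ _ _ _)]
    refine intervalIntegral.integral_congr fun s hs => ?_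
    rw [uIcc_of_le ht] at hs
    rw [← hK, hwz s hs.1]
  have hI1 : IntervalIntegrable (fun s => heatKN (t - s) (z s) (w t)) volume 0 (1 / 2) := by
    refine ((intervalIntegrable_source (w := fun _ => 0) continuous_const t 0 (1 / 2)
      (w t)).const_mul 2).congr fun s hs => ?_
    rw [uIoc_of_le (by norm_num)] at hs
    simp only [heatKN, hzext s hs.1.le hs.2, zero_sub, zero_add, heatK_neg, sub_zero]
    ring
  have hI2 : IntervalIntegrable (fun s => heatKN (t - s) (z s) (w t)) volume (1 / 2) t := by
    refine ((intervalIntegrable_source hw t (1 / 2) t (w t)).add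
      (intervalIntegrable_source hw t (1 / 2) t (-w t))).congr fun s hs => ?_
    rw [uIoc_of_le ht] at hs
    rw [← hwz s hs.1.le, hK]
  rw [← hwz t ht, ← intervalIntegral.integral_add_adjacent_intervals hI1 hI2, hleft, hright,
    ← add_assoc, free_evolution_eq h, hbdy t h, hreflect]
  ring
end

section
/- Monotonicity of the Neumann kernel difference: for every t > 0 and every z′ ≥ 0, the function z ↦ p_N(t, z, z′) − p_N(t, z, 0) = p(t, z − z′) + p(t, z + z′) − 2p(t, z) is nondecreasing in z on the interval [0, z′]; equivalently, its partial derivative in z is nonnegative: z′(e^{−(z−z′)²/2t} − e^{−(z+z′)²/2t}) − z(e^{−(z−z′)²/2t} + e^{−(z+z′)²/2t}) + 2z e^{−z²/2t} ≥ 0 for 0 ≤ z ≤ z′. -/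
open MeasureTheory Real Set

/-- The space derivative of the heat kernel is `-(x / t) p(t,x)`. -/
theorem hasDerivAt_heatK {t : ℝ} (ht : t ≠ 0) (x : ℝ) :
    HasDerivAt (heatK t)
      ((Real.sqrt (2 * Real.pi * t))⁻¹ * (Real.exp (-x ^ 2 / (2 * t)) * (-x / t))) x := by
  have h : HasDerivAt (fun y : ℝ => -y ^ 2 / (2 * t)) (-x / t) x := by
    refine ((hasDerivAt_pow 2 x).fun_neg.div_const (2 * t)).congr_deriv ?_
    field_simp
    norm_num
  exact h.exp.const_mul _

/-- The derivative expression of the Neumann kernel difference is nonnegative. -/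
theorem neumann_derivative_nonneg {t z z' : ℝ} (ht : 0 < t) (hz : z ∈ Set.Icc 0 z') :
    0 ≤ z' * (Real.exp (-(z - z') ^ 2 / (2 * t)) - Real.exp (-(z + z') ^ 2 / (2 * t)))
        - z * (Real.exp (-(z - z') ^ 2 / (2 * t)) + Real.exp (-(z + z') ^ 2 / (2 * t)))
        + 2 * z * Real.exp (-z ^ 2 / (2 * t)) := by
  obtain ⟨h0, h1⟩ := hz
  have hle : Real.exp (-(z + z') ^ 2 / (2 * t)) ≤ Real.exp (-(z - z') ^ 2 / (2 * t)) := by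
    gcongr Real.exp (?_ / _)
    nlinarith [mul_nonneg h0 (h0.trans h1)]
  have hle' : Real.exp (-(z + z') ^ 2 / (2 * t)) ≤ Real.exp (-z ^ 2 / (2 * t)) := by
    gcongr Real.exp (?_ / _)
    nlinarith [mul_nonneg h0 (h0.trans h1), sq_nonneg z']
  nlinarith [mul_nonneg (sub_nonneg.2 h1) (sub_nonneg.2 hle),
    mul_nonneg h0 (sub_nonneg.2 hle')]

/-- Monotonicity of the Neumann kernel difference: for `t > 0` and `z' ≥ 0`, the function
`z ↦ p_N(t,z,z') - p_N(t,z,0)` is nondecreasing on `[0,z']`; equivalently, the corresponding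
derivative expression is nonnegative there. -/
theorem neumann_kernel_difference_monotone (t : ℝ) (ht : 0 < t) (z' : ℝ) (hz' : 0 ≤ z') :
    MonotoneOn (fun z : ℝ => heatKN t z z' - heatKN t z 0) (Set.Icc 0 z') ∧
    ∀ z ∈ Set.Icc (0:ℝ) z',
      0 ≤ z' * (Real.exp (-(z - z') ^ 2 / (2 * t)) - Real.exp (-(z + z') ^ 2 / (2 * t)))
          - z * (Real.exp (-(z - z') ^ 2 / (2 * t)) + Real.exp (-(z + z') ^ 2 / (2 * t)))
          + 2 * z * Real.exp (-z ^ 2 / (2 * t)) := by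
  refine ⟨?_, fun z hz => neumann_derivative_nonneg ht hz⟩
  have hd : ∀ z : ℝ, HasDerivAt (fun z : ℝ => heatKN t z z' - heatKN t z 0)
      ((Real.sqrt (2 * Real.pi * t))⁻¹ / t *
        (z' * (Real.exp (-(z - z') ^ 2 / (2 * t)) - Real.exp (-(z + z') ^ 2 / (2 * t)))
          - z * (Real.exp (-(z - z') ^ 2 / (2 * t)) + Real.exp (-(z + z') ^ 2 / (2 * t)))
          + 2 * z * Real.exp (-z ^ 2 / (2 * t)))) z := by
    intro z
    have hsub (y : ℝ) := (hasDerivAt_heatK ht.ne' (z - y)).comp_sub_const z y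
    have hadd (y : ℝ) := (hasDerivAt_heatK ht.ne' (z + y)).comp_add_const z y
    refine (((hsub z').fun_add (hadd z')).fun_sub ((hsub 0).fun_add (hadd 0))).congr_deriv ?_
    simp only [sub_zero, add_zero]
    ring
  refine monotoneOn_of_hasDerivWithinAt_nonneg (convex_Icc 0 z')
    (fun z _ => (hd z).continuousAt.continuousWithinAt)
    (fun z _ => (hd z).hasDerivWithinAt) fun z hz => ?_
  exact mul_nonneg (by positivity) (neumann_derivative_nonneg ht (interior_subset hz))
end
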